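/- arXiv:math/0401235 — 2 statements merged into one kernel-verified Lean document; each statement's English description precedes it below -/
import Mathlib

section
/- Let n ≥ 1 and c ≥ 1 be integers. Then F_q(n−1,n,c,n;1) = q^{(n+2)(n−1)/2} G_{n−1,c−1,0} in ℚ(q). -/
open Finset

noncomputable def q : RatFunc ℚ := RatFunc.X

noncomputable def qb (a : ℤ) : RatFunc ℚ := (1 - q ^ a) / (1 - q)

noncomputable def qfac (a : ℤ) (n : ℕ) : RatFunc ℚ := ∏ i ∈ Finset.range n, qb (a + i)

noncomputable def binq (n k : ℤ) : RatFunc ℚ :=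
  if 0 ≤ k ∧ k ≤ n then qfac (n - k + 1) k.toNat / qfac 1 k.toNat else 0

/-- A generalized `(r,n,c)` Gelfand-Tsetlin pattern, encoded as `a : ℕ → ℕ → ℤ` with
rows `i = 1,…,r+1`, entries `a i j` for `i-1 ≤ j ≤ n+1`, and `a i j = 0` outside this
trapezoidal domain (a harmless normalization). -/
def IsPattern (r n c : ℕ) (a : ℕ → ℕ → ℤ) : Prop :=
  (∀ i, 1 ≤ i → i ≤ r + 1 → a i (i - 1) = 0 ∧ a i (n + 1) = c) ∧
  (∀ i j, 2 ≤ i → i ≤ r + 1 → i ≤ j + 1 → j ≤ n →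
    ((a i j ≤ a i (j + 1) → a i j ≤ a (i - 1) j ∧ a (i - 1) j ≤ a i (j + 1)) ∧
     (a i (j + 1) < a i j → a i (j + 1) < a (i - 1) j ∧ a (i - 1) j < a i j))) ∧
  (∀ i j, i = 0 ∨ r + 1 < i ∨ j + 1 < i ∨ n + 1 < j → a i j = 0)

/-- The norm of a pattern: the sum of all entries, omitting the first and last entry
of each row. -/
def patNorm (r n : ℕ) (a : ℕ → ℕ → ℤ) : ℤ :=
  ∑ i ∈ Finset.Icc 1 (r + 1), ∑ j ∈ Finset.Icc i n, a i j

/-- The number of inversions: pairs `(a i j, a i (j+1))` with `a i j > a i (j+1)`, `i ≠ 1`. -/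
noncomputable def invCount (r n : ℕ) (a : ℕ → ℕ → ℤ) : ℕ :=
  {ij : ℕ × ℕ | 2 ≤ ij.1 ∧ ij.1 ≤ r + 1 ∧ ij.1 ≤ ij.2 + 1 ∧ ij.2 ≤ n ∧
    a ij.1 (ij.2 + 1) < a ij.1 ij.2}.ncard

/-- The sign of a pattern. -/
noncomputable def patSign (r n : ℕ) (a : ℕ → ℕ → ℤ) : RatFunc ℚ := (-1) ^ invCount r n a

/-- The number of odd entries among `a 1 1, …, a 1 n`. -/
noncomputable def oddTop (n : ℕ) (a : ℕ → ℕ → ℤ) : ℕ :=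
  {j | 1 ≤ j ∧ j ≤ n ∧ Odd (a 1 j)}.ncard

/-- `Fq n c p k` is `F_q(n-1,n,c,p;k)`: the signed generating function of
`(n-1,n,c)`-patterns with `a n n = k` and exactly `p` odd entries in the bottom row,
divided by `q^k`. -/
noncomputable def Fq (n c p : ℕ) (k : ℤ) : RatFunc ℚ :=
  (∑ᶠ a ∈ {a : ℕ → ℕ → ℤ | IsPattern (n - 1) n c a ∧ a n n = k ∧ oddTop n a = p},
    patSign (n - 1) n a * q ^ patNorm (n - 1) n a) / q ^ k

/-- A strict plane partition: entries `part i j` (row `i`, column `j`, both 0-indexed),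
zero outside the shape; rows weakly decrease and columns strictly decrease on the shape. -/
structure SPP where
  part : ℕ → ℕ → ℕ
  supp_finite : {ij : ℕ × ℕ | part ij.1 ij.2 ≠ 0}.Finite
  row_decr : ∀ i j₁ j₂, j₁ ≤ j₂ → part i j₂ ≤ part i j₁
  col_strict : ∀ i j, part (i + 1) j ≠ 0 → part (i + 1) j < part i j

/-- The norm of a strict plane partition: the sum of its parts. -/
noncomputable def sppNorm (P : SPP) : ℕ := ∑ᶠ ij : ℕ × ℕ, P.part ij.1 ij.2

/-- The length of the `i`-th row (0-indexed), i.e. the part `λ_{i+1}` of the shape. -/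
noncomputable def rowLen (P : SPP) (i : ℕ) : ℕ := {j | P.part i j ≠ 0}.ncard

/-- The number of rows of odd length. -/
noncomputable def oddRows (P : SPP) : ℕ := {i | Odd (rowLen P i)}.ncard

/-- The number of parts equal to `n`. -/
noncomputable def eqCount (P : SPP) (n : ℕ) : ℕ := {ij : ℕ × ℕ | P.part ij.1 ij.2 = n}.ncard

/-- `Gspp n c p` is `G_{n,c,p}`: the generating function of strict plane partitions with
parts in `{1,…,n}`, at most `c` columns and exactly `p` rows of odd length. -/
noncomputable def Gspp (n c p : ℕ) : RatFunc ℚ :=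
  ∑ᶠ P ∈ {P : SPP | (∀ i j, P.part i j ≤ n) ∧ (∀ i j, c ≤ j → P.part i j = 0) ∧
      oddRows P = p}, q ^ sppNorm P

/-- The number of parts at least `i` in row `r`. -/
noncomputable def countGE (P : SPP) (r i : ℕ) : ℕ := {k | i ≤ P.part r k}.ncard

theorem lt_countGE (P : SPP) (r : ℕ) {i : ℕ} (hi : 1 ≤ i) (k : ℕ) :
    k < countGE P r i ↔ i ≤ P.part r k := by
  have hfin : {k | i ≤ P.part r k}.Finite := by
    refine (P.supp_finite.preimage (f := fun k => (r, k)) ?_).subset ?_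
    · intro x _ y _ h
      simpa using h
    · intro k hk
      have hk : i ≤ P.part r k := hk
      change P.part r k ≠ 0
      omega
  have hex : ∃ k, ¬ i ≤ P.part r k := by
    by_contra! h
    exact Set.infinite_univ (hfin.subset fun k _ => h k)
  have hset : {k | i ≤ P.part r k} = Set.Iio (Nat.find hex) := by
    ext k
    constructor
    · intro hk
      by_contra hlt
      exact Nat.find_spec hex (le_trans hk (P.row_decr r _ _ (not_lt.mp hlt)))
    · intro hk
      exact not_not.mp (Nat.find_min hex hk)
  have hcard : countGE P r i = Nat.find hex := by
    rw [countGE, hset, ← Finset.coe_Iio, Set.ncard_coe_finset, Nat.card_Iio]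
  rw [hcard]
  exact (Set.ext_iff.mp hset k).symm

theorem countGE_le_iff (P : SPP) (r : ℕ) {i : ℕ} (hi : 1 ≤ i) (N : ℕ) :
    countGE P r i ≤ N ↔ P.part r N < i := by
  rw [← not_lt, lt_countGE P r hi, not_le]

theorem countGE_mono (P : SPP) {r s i j : ℕ} (hi : 1 ≤ i) (hj : 1 ≤ j)
    (h : ∀ k, i ≤ P.part r k → j ≤ P.part s k) : countGE P r i ≤ countGE P s j := by
  by_contra! hlt
  exact lt_irrefl _ ((lt_countGE P s hj _).mpr (h _ ((lt_countGE P r hi _).mp hlt)))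

theorem rowLen_eq_countGE (P : SPP) (r : ℕ) : rowLen P r = countGE P r 1 := by
  simp only [rowLen, countGE, Nat.one_le_iff_ne_zero]

theorem part_add_le {m : ℕ} (P : SPP) (hP : ∀ i j, P.part i j ≤ m) (r k : ℕ) :
    P.part r k ≤ m - r := by
  induction r with
  | zero => simpa using hP 0 k
  | succ r ih =>
    by_cases h : P.part (r + 1) k = 0
    · omega
    · have := P.col_strict r k h
      omega

theorem countGE_eq_zero {m : ℕ} (P : SPP) (hP : ∀ i j, P.part i j ≤ m) {r i : ℕ}
    (hi : 1 ≤ i) (h : m < r + i) : countGE P r i = 0 := by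
  have := (countGE_le_iff P r hi 0).mpr (by have := part_add_le P hP r 0; omega)
  omega

/-- The strict plane partitions with parts in `{1,…,m}` and at most `c` columns, all of whose
rows have even length. -/
def evenSPP (m c : ℕ) : Set SPP :=
  {P : SPP | (∀ i j, P.part i j ≤ m) ∧ (∀ i j, c ≤ j → P.part i j = 0) ∧ oddRows P = 0}

theorem oddRows_eq_zero_iff {m : ℕ} (P : SPP) (hP : ∀ i j, P.part i j ≤ m) :
    oddRows P = 0 ↔ ∀ r, r ≤ m → Even (countGE P r 1) := by
  have hfin : {i | Odd (rowLen P i)}.Finite := by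
    refine (Set.finite_Iio m).subset fun r hr => ?_
    have hr : Odd (rowLen P r) := hr
    by_contra hlt
    have hlt : m ≤ r := by simpa using hlt
    rw [rowLen_eq_countGE, countGE_eq_zero P hP le_rfl (by omega)] at hr
    simp at hr
  rw [oddRows, Set.ncard_eq_zero hfin, Set.eq_empty_iff_forall_notMem]
  simp only [Set.mem_ofPred_eq, rowLen_eq_countGE, Nat.not_odd_iff_even]
  refine ⟨fun h r _ => h r, fun h r => ?_⟩
  by_cases hr : r ≤ m
  · exact h r hr
  · rw [countGE_eq_zero P hP le_rfl (by omega)]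
    simp

theorem oddTop_eq_iff (n : ℕ) (a : ℕ → ℕ → ℤ) :
    oddTop n a = n ↔ ∀ j, 1 ≤ j → j ≤ n → Odd (a 1 j) := by
  have hsub : {j | 1 ≤ j ∧ j ≤ n ∧ Odd (a 1 j)} ⊆ (Finset.Icc 1 n : Set ℕ) := by
    intro j hj
    simpa using And.intro hj.1 hj.2.1
  have hcard : (Finset.Icc 1 n : Set ℕ).ncard = n := by
    rw [Set.ncard_coe_finset, Nat.card_Icc, Nat.add_sub_cancel]
  constructor
  · intro h j h1 h2
    have heq := Set.eq_of_subset_of_ncard_le hsub (by rw [hcard]; exact h.ge)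
      (Finset.finite_toSet _)
    have hj : j ∈ (Finset.Icc 1 n : Set ℕ) := by simpa using And.intro h1 h2
    rw [← heq] at hj
    exact hj.2.2
  · intro h
    have heq : {j | 1 ≤ j ∧ j ≤ n ∧ Odd (a 1 j)} = (Finset.Icc 1 n : Set ℕ) := by
      refine Set.Subset.antisymm hsub fun j hj => ?_
      have hj : 1 ≤ j ∧ j ≤ n := by simpa using hj
      exact ⟨hj.1, hj.2, h j hj.1 hj.2⟩
    rw [oddTop, heq, hcard]

/-- The patterns contributing to `Fq (m + 1) c (m + 1) 1`. -/
def oddPatterns (m c : ℕ) : Set (ℕ → ℕ → ℤ) :=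
  {a : ℕ → ℕ → ℤ | IsPattern m (m + 1) c a ∧ a (m + 1) (m + 1) = 1 ∧ oddTop (m + 1) a = m + 1}

namespace IsPattern

variable {m c : ℕ} {a : ℕ → ℕ → ℤ}

theorem row_le_succ (ha : IsPattern m (m + 1) c a) (hc : 1 ≤ c) (h1 : a (m + 1) (m + 1) = 1)
    {i j : ℕ} (hi : 1 ≤ i) (him : i ≤ m + 1) (hij : i ≤ j + 1) (hj : j ≤ m + 1) :
    a i j ≤ a i (j + 1) := by
  obtain ⟨hb, hinter, -⟩ := ha
  induction him using Nat.decreasingInduction generalizing j with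
  | self =>
    obtain ⟨h0, h2⟩ := hb (m + 1) hi le_rfl
    obtain rfl | rfl : j = m ∨ j = m + 1 := by omega
    · have : a (j + 1) j = 0 := h0
      omega
    · omega
  | of_succ k hk ih =>
    have hbetween : ∀ j, k ≤ j → j ≤ m + 1 → a (k + 1) j ≤ a k j ∧ a k j ≤ a (k + 1) (j + 1) := by
      intro j h1 h2
      exact (hinter (k + 1) j (by omega) (by omega) (by omega) h2).1 (ih (by omega) (by omega) h2)
    obtain ⟨h0, hn⟩ := hb k hi (by omega)
    obtain ⟨h0', hn'⟩ := hb (k + 1) (by omega) (by omega)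
    rcases Nat.lt_or_ge j k with hjk | hjk
    · obtain rfl : k = j + 1 := by omega
      have e1 : a (j + 1) j = 0 := h0
      have e2 : a (j + 1 + 1) (j + 1) = 0 := h0'
      have := (hbetween (j + 1) le_rfl (by omega)).1
      omega
    · rcases Nat.lt_or_ge j (m + 1) with hjm | hjm
      · have := (hbetween j hjk hj).2
        have := (hbetween (j + 1) (by omega) (by omega)).1
        omega
      · obtain rfl : j = m + 1 := by omega
        have := (hbetween (m + 1) hjk le_rfl).2
        omega

theorem interlace (ha : IsPattern m (m + 1) c a) (hc : 1 ≤ c) (h1 : a (m + 1) (m + 1) = 1)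
    {i j : ℕ} (hi : 1 ≤ i) (him : i ≤ m) (hij : i ≤ j) (hj : j ≤ m + 1) :
    a (i + 1) j ≤ a i j ∧ a i j ≤ a (i + 1) (j + 1) :=
  (ha.2.1 (i + 1) j (by omega) (by omega) (by omega) hj).1
    (ha.row_le_succ hc h1 (by omega) (by omega) (by omega) hj)

theorem row_mono (ha : IsPattern m (m + 1) c a) (hc : 1 ≤ c) (h1 : a (m + 1) (m + 1) = 1)
    {i j l : ℕ} (hi : 1 ≤ i) (him : i ≤ m + 1) (hij : i ≤ j + 1) (hjl : j ≤ l)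
    (hl : l ≤ m + 2) : a i j ≤ a i l := by
  induction hjl with
  | refl => exact le_rfl
  | @step l hjl ih =>
    have hjl : j ≤ l := hjl
    exact (ih (by omega)).trans (ha.row_le_succ hc h1 hi him (by omega) (by omega))

theorem col_antitone (ha : IsPattern m (m + 1) c a) (hc : 1 ≤ c) (h1 : a (m + 1) (m + 1) = 1)
    {i k j : ℕ} (hi : 1 ≤ i) (hik : i ≤ k) (hkj : k ≤ j) (hj : j ≤ m + 1) :
    a k j ≤ a i j := by
  induction hik with
  | refl => exact le_rfl
  | @step k hik ih =>
    have hik : i ≤ k := hik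
    exact (ha.interlace hc h1 (by omega) (by omega) (by omega) hj).1.trans (ih (by omega))

theorem diag_mono (ha : IsPattern m (m + 1) c a) (hc : 1 ≤ c) (h1 : a (m + 1) (m + 1) = 1)
    {i k : ℕ} (hi : 1 ≤ i) (hik : i ≤ k) (hk : k ≤ m + 1) : a i i ≤ a k k := by
  induction hik with
  | refl => exact le_rfl
  | @step k hik ih =>
    have hik : i ≤ k := hik
    exact (ih (by omega)).trans (ha.interlace hc h1 (by omega) (by omega) le_rfl (by omega)).2

theorem diag_eq_one (ha : IsPattern m (m + 1) c a) (hc : 1 ≤ c) (h1 : a (m + 1) (m + 1) = 1)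
    (hodd : Odd (a 1 1)) {i : ℕ} (hi : 1 ≤ i) (him : i ≤ m + 1) : a i i = 1 := by
  have h0 : a 1 0 = 0 := (ha.1 1 le_rfl (by omega)).1
  have h2 := ha.row_le_succ hc h1 (i := 1) (j := 0) le_rfl (by omega) (by omega) (by omega)
  have h3 := ha.diag_mono hc h1 le_rfl hi him
  have h4 := ha.diag_mono hc h1 hi him le_rfl
  obtain ⟨t, ht⟩ := hodd
  simp only [zero_add] at h2
  omega

theorem invCount_eq_zero (ha : IsPattern m (m + 1) c a) (hc : 1 ≤ c)
    (h1 : a (m + 1) (m + 1) = 1) : invCount m (m + 1) a = 0 := by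
  rw [invCount]
  convert Set.ncard_empty (ℕ × ℕ)
  refine Set.eq_empty_iff_forall_notMem.mpr ?_
  rintro ⟨i, j⟩ ⟨h2, h3, h4, h5, h6⟩
  exact absurd h6 (not_lt.mpr (ha.row_le_succ hc h1 (by omega) h3 h4 h5))

end IsPattern

/-- Row `i` of the pattern records, up to a shift by one, the numbers of parts at least `i` in
the rows of `P`. -/
noncomputable def toPattern (m c : ℕ) (P : SPP) (i j : ℕ) : ℤ :=
  if 1 ≤ i ∧ i ≤ j ∧ j ≤ m + 1 then 1 + (countGE P (m + 1 - j) i : ℤ)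
  else if 1 ≤ i ∧ i ≤ m + 1 ∧ j = m + 2 then c else 0

theorem toPattern_of_le {m c : ℕ} {P : SPP} {i j : ℕ} (hi : 1 ≤ i) (hij : i ≤ j)
    (hj : j ≤ m + 1) : toPattern m c P i j = 1 + (countGE P (m + 1 - j) i : ℤ) :=
  if_pos ⟨hi, hij, hj⟩

theorem toPattern_last {m c : ℕ} {P : SPP} {i : ℕ} (hi : 1 ≤ i) (him : i ≤ m + 1) :
    toPattern m c P i (m + 2) = c := by
  rw [toPattern, if_neg (by omega), if_pos ⟨hi, him, rfl⟩]

theorem toPattern_eq_zero {m c : ℕ} {P : SPP} {i j : ℕ}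
    (h : i = 0 ∨ m + 1 < i ∨ j < i ∨ m + 2 < j) : toPattern m c P i j = 0 := by
  rw [toPattern, if_neg (by omega), if_neg (by omega)]

theorem isPattern_toPattern {m c : ℕ} (hc : 1 ≤ c) {P : SPP}
    (hcol : ∀ i j, c - 1 ≤ j → P.part i j = 0) :
    IsPattern m (m + 1) c (toPattern m c P) := by
  refine ⟨fun i hi him => ⟨toPattern_eq_zero (by omega), toPattern_last hi him⟩, ?_, ?_⟩
  · intro i j hi him hij hj
    obtain ⟨i, rfl⟩ : ∃ k, i = k + 1 := ⟨i - 1, by omega⟩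
    suffices h : toPattern m c P (i + 1) j ≤ toPattern m c P i j ∧
        toPattern m c P i j ≤ toPattern m c P (i + 1) (j + 1) from
      ⟨fun _ => h, fun h' => absurd (h.1.trans h.2) (not_le.mpr h')⟩
    rw [toPattern_of_le (i := i) (by omega) (by omega) hj]
    constructor
    · rcases Nat.lt_or_ge i j with h | h
      · rw [toPattern_of_le (by omega) (by omega) hj]
        have := countGE_mono P (r := m + 1 - j) (s := m + 1 - j) (i := i + 1) (j := i) (by omega)
          (by omega) (fun k hk => by omega)
        omega
      · rw [toPattern_eq_zero (by omega)]
        omega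
    · rcases Nat.lt_or_ge j (m + 1) with h | h
      · rw [toPattern_of_le (by omega) (by omega) (by omega)]
        have := countGE_mono P (r := m + 1 - j) (s := m + 1 - (j + 1)) (i := i) (j := i + 1)
          (by omega) (by omega) (fun k hk => by
            have e : m + 1 - j = m + 1 - (j + 1) + 1 := by omega
            rw [e] at hk
            have := P.col_strict (m + 1 - (j + 1)) k (by omega)
            omega)
        omega
      · obtain rfl : j = m + 1 := by omega
        rw [toPattern_last (by omega) (by omega)]
        have := (countGE_le_iff P (m + 1 - (m + 1)) (i := i) (by omega) (c - 1)).mpr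
          (by rw [hcol _ _ le_rfl]; omega)
        omega
  · intro i j h
    rcases Nat.lt_or_ge j i with h' | h'
    · exact toPattern_eq_zero (by omega)
    · exact toPattern_eq_zero (by omega)

theorem toPattern_mem {m c : ℕ} (hc : 1 ≤ c) {P : SPP} (hP : P ∈ evenSPP m (c - 1)) :
    toPattern m c P ∈ oddPatterns m c := by
  obtain ⟨hm, hcol, hodd⟩ := hP
  refine ⟨isPattern_toPattern hc hcol, ?_, ?_⟩
  · rw [toPattern_of_le (by omega) le_rfl le_rfl, countGE_eq_zero P hm (by omega) (by omega)]
    simp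
  · rw [oddTop_eq_iff]
    intro j h1 h2
    rw [toPattern_of_le le_rfl h1 h2]
    obtain ⟨t, ht⟩ := (oddRows_eq_zero_iff P hm).mp hodd (m + 1 - j) (by omega)
    exact ⟨t, by omega⟩

theorem SPP.ext_part {P Q : SPP} (h : ∀ r k, P.part r k = Q.part r k) : P = Q := by
  obtain ⟨p, _, _, _⟩ := P
  obtain ⟨p', _, _, _⟩ := Q
  obtain rfl : p = p' := funext fun r => funext fun k => h r k
  rfl

theorem toPattern_injOn (m c : ℕ) : Set.InjOn (toPattern m c) (evenSPP m (c - 1)) := by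
  intro P hP Q hQ h
  have key : ∀ r i, 1 ≤ i → countGE P r i = countGE Q r i := by
    intro r i hi
    by_cases hr : m < r + i
    · rw [countGE_eq_zero P hP.1 hi hr, countGE_eq_zero Q hQ.1 hi hr]
    · have hij := congrFun (congrFun h i) (m + 1 - r)
      rw [toPattern_of_le hi (by omega) (by omega), toPattern_of_le hi (by omega) (by omega)] at hij
      have e : m + 1 - (m + 1 - r) = r := by omega
      rw [e] at hij
      omega
  refine SPP.ext_part fun r k => ?_
  have hle : ∀ i, i ≤ P.part r k ↔ i ≤ Q.part r k := by
    intro i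
    rcases Nat.eq_zero_or_pos i with rfl | hi
    · simp
    · rw [← lt_countGE P r hi, ← lt_countGE Q r hi, key r i hi]
  exact le_antisymm ((hle _).mp le_rfl) ((hle _).mpr le_rfl)

theorem le_findGreatest_iff {p : ℕ → Prop} [DecidablePred p] {N i : ℕ} (hi : 1 ≤ i)
    (hp : ∀ a b, 1 ≤ a → a ≤ b → b ≤ N → p b → p a) :
    i ≤ Nat.findGreatest p N ↔ i ≤ N ∧ p i := by
  constructor
  · intro h
    have hN := Nat.findGreatest_le (P := p) N
    exact ⟨h.trans hN, hp _ _ hi h hN (Nat.findGreatest_of_ne_zero rfl (by omega))⟩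
  · rintro ⟨h1, h2⟩
    exact Nat.le_findGreatest h1 h2

/-- The entries of the strict plane partition attached to a pattern. -/
def partOf (m : ℕ) (a : ℕ → ℕ → ℤ) (r k : ℕ) : ℕ :=
  Nat.findGreatest (fun i => (k : ℤ) + 1 < a i (m + 1 - r)) (m - r)

theorem partOf_le (m : ℕ) (a : ℕ → ℕ → ℤ) (r k : ℕ) : partOf m a r k ≤ m - r :=
  Nat.findGreatest_le _

section Inverse

variable {m c : ℕ} {a : ℕ → ℕ → ℤ}

theorem le_partOf_iff (ha : IsPattern m (m + 1) c a) (hc : 1 ≤ c)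
    (h1 : a (m + 1) (m + 1) = 1) {r k i : ℕ} (hi : 1 ≤ i) :
    i ≤ partOf m a r k ↔ i ≤ m - r ∧ (k : ℤ) + 1 < a i (m + 1 - r) := by
  refine le_findGreatest_iff hi fun x y hx hxy hy h => ?_
  exact h.trans_le (ha.col_antitone hc h1 hx hxy (by omega) (by omega))

theorem partOf_eq_zero (ha : IsPattern m (m + 1) c a) (hc : 1 ≤ c)
    (h1 : a (m + 1) (m + 1) = 1) {r k : ℕ} (hk : c - 1 ≤ k) : partOf m a r k = 0 := by
  by_contra h
  have hk' := (le_partOf_iff ha hc h1 le_rfl).mp (Nat.one_le_iff_ne_zero.mpr h)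
  have h2 := ha.row_mono hc h1 (i := 1) (j := m + 1 - r) (l := m + 2) le_rfl (by omega)
    (by omega) (by omega) le_rfl
  have h3 : a 1 (m + 2) = c := (ha.1 1 le_rfl (by omega)).2
  omega

/-- The strict plane partition attached to a pattern. -/
def sppOf (ha : IsPattern m (m + 1) c a) (hc : 1 ≤ c) (h1 : a (m + 1) (m + 1) = 1) : SPP where
  part := partOf m a
  supp_finite := by
    refine ((Set.finite_Iio m).prod (Set.finite_Iio c)).subset ?_
    rintro ⟨r, k⟩ h
    have h : partOf m a r k ≠ 0 := h
    have := partOf_le m a r k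
    refine ⟨?_, ?_⟩
    · change r < m
      omega
    · change k < c
      by_contra hk
      exact h (partOf_eq_zero ha hc h1 (by omega))
  row_decr := by
    intro r k₁ k₂ hk
    rcases Nat.eq_zero_or_pos (partOf m a r k₂) with h | h
    · omega
    · have := (le_partOf_iff ha hc h1 h).mp le_rfl
      exact (le_partOf_iff ha hc h1 h).mpr ⟨this.1, by omega⟩
  col_strict := by
    intro r k h
    obtain ⟨h2, h3⟩ := (le_partOf_iff ha hc h1 (Nat.one_le_iff_ne_zero.mpr h)).mp le_rfl
    refine (le_partOf_iff ha hc h1 (by omega)).mpr ⟨by omega, ?_⟩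
    have := (ha.interlace hc h1 (i := partOf m a (r + 1) k) (j := m + 1 - (r + 1))
      (by omega) (by omega) (by omega) (by omega)).2
    have e : m + 1 - (r + 1) + 1 = m + 1 - r := by omega
    rw [e] at this
    exact h3.trans_le this

theorem toPattern_sppOf (ha : IsPattern m (m + 1) c a) (hc : 1 ≤ c)
    (h1 : a (m + 1) (m + 1) = 1) (hodd : Odd (a 1 1)) :
    toPattern m c (sppOf ha hc h1) = a := by
  funext i j
  by_cases hout : i = 0 ∨ m + 1 < i ∨ j < i ∨ m + 2 < j
  · rw [toPattern_eq_zero hout]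
    rcases Nat.lt_or_ge j (i - 1) with h | h
    · exact (ha.2.2 i j (by omega)).symm
    · by_cases h' : 1 ≤ i ∧ i ≤ m + 1 ∧ j = i - 1
      · rw [h'.2.2, (ha.1 i h'.1 h'.2.1).1]
      · exact (ha.2.2 i j (by omega)).symm
  · rcases Nat.lt_or_ge (m + 1) j with h | h
    · obtain rfl : j = m + 2 := by omega
      rw [toPattern_last (by omega) (by omega)]
      exact ((ha.1 i (by omega) (by omega)).2).symm
    · rw [toPattern_of_le (by omega) (by omega) h]
      have hd := ha.diag_eq_one hc h1 hodd (i := i) (by omega) (by omega)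
      have hle := ha.row_mono hc h1 (i := i) (j := i) (l := j) (by omega) (by omega) (by omega)
        (by omega) (by omega)
      have hcount : countGE (sppOf ha hc h1) (m + 1 - j) i = (a i j - 1).toNat := by
        refine eq_of_forall_lt_iff fun k => ?_
        rw [lt_countGE _ _ (by omega)]
        have e : m + 1 - (m + 1 - j) = j := by omega
        refine (le_partOf_iff ha hc h1 (by omega)).trans ?_
        rw [e]
        rcases eq_or_ne i j with rfl | hne
        · omega
        · omega
      rw [hcount]
      omega

theorem toPattern_surjOn (hc : 1 ≤ c) :
    Set.SurjOn (toPattern m c) (evenSPP m (c - 1)) (oddPatterns m c) := by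
  rintro a ⟨ha, h1, hodd⟩
  rw [oddTop_eq_iff] at hodd
  have heq := toPattern_sppOf ha hc h1 (hodd 1 le_rfl (by omega))
  have hm : ∀ r k, (sppOf ha hc h1).part r k ≤ m := fun r k =>
    (partOf_le m a r k).trans (Nat.sub_le _ _)
  refine ⟨sppOf ha hc h1, ⟨hm, fun r k hk => partOf_eq_zero ha hc h1 hk, ?_⟩, heq⟩
  rw [oddRows_eq_zero_iff _ hm]
  intro r hr
  have h2 := hodd (m + 1 - r) (by omega) (by omega)
  rw [← heq, toPattern_of_le le_rfl (by omega) (by omega)] at h2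
  have e : m + 1 - (m + 1 - r) = r := by omega
  rw [e] at h2
  obtain ⟨t, ht⟩ := h2
  exact ⟨t.toNat, by omega⟩

end Inverse

theorem sppNorm_eq_sum_countGE {m c : ℕ} {P : SPP} (hP : ∀ i j, P.part i j ≤ m)
    (hcol : ∀ i j, c ≤ j → P.part i j = 0) :
    sppNorm P = ∑ i ∈ Finset.Icc 1 (m + 1), ∑ r ∈ Finset.range (m + 1), countGE P r i := by
  have hcount : ∀ r i, 1 ≤ i →
      countGE P r i = ∑ k ∈ Finset.range c, if i ≤ P.part r k then 1 else 0 := by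
    intro r i hi
    have hle := (countGE_le_iff P r hi c).mpr (by rw [hcol _ _ le_rfl]; omega)
    rw [← Finset.card_filter]
    conv_lhs => rw [← Finset.card_range (countGE P r i)]
    congr 1
    ext k
    rw [Finset.mem_filter, Finset.mem_range, Finset.mem_range, lt_countGE P r hi]
    refine ⟨fun h => ⟨?_, h⟩, fun h => h.2⟩
    exact ((lt_countGE P r hi k).mpr h).trans_le hle
  have hpart : ∀ r k, P.part r k =
      ∑ i ∈ Finset.Icc 1 (m + 1), if i ≤ P.part r k then 1 else 0 := by
    intro r k
    rw [← Finset.card_filter]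
    have : {i ∈ Finset.Icc 1 (m + 1) | i ≤ P.part r k} = Finset.Icc 1 (P.part r k) := by
      ext i
      have := hP r k
      simp only [Finset.mem_filter, Finset.mem_Icc]
      omega
    rw [this, Nat.card_Icc, Nat.add_sub_cancel]
  have hsupp : (Function.support fun x : ℕ × ℕ => P.part x.1 x.2) ⊆
      (Finset.range (m + 1) ×ˢ Finset.range c : Finset (ℕ × ℕ)) := by
    rintro ⟨r, k⟩ h
    have h : P.part r k ≠ 0 := h
    have := part_add_le P hP r k
    simp only [Finset.coe_product, Finset.coe_range, Set.mem_prod, Set.mem_Iio]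
    refine ⟨by omega, ?_⟩
    by_contra hk
    exact h (hcol r k (by omega))
  rw [sppNorm, finsum_eq_sum_of_support_subset _ hsupp, Finset.sum_product,
    Finset.sum_comm (s := Finset.Icc 1 (m + 1))]
  refine Finset.sum_congr rfl fun r _ => ?_
  rw [Finset.sum_congr rfl fun k _ => hpart r k, Finset.sum_comm]
  exact Finset.sum_congr rfl fun i hi => (hcount r i (Finset.mem_Icc.mp hi).1).symm

theorem patNorm_toPattern {m c d : ℕ} {P : SPP} (hP : ∀ i j, P.part i j ≤ m)
    (hcol : ∀ i j, d ≤ j → P.part i j = 0) :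
    patNorm m (m + 1) (toPattern m c P) =
      (∑ i ∈ Finset.Icc 1 (m + 1), ((m + 2 - i : ℕ) : ℤ)) + sppNorm P := by
  rw [patNorm, sppNorm_eq_sum_countGE hP hcol]
  push_cast
  rw [← Finset.sum_add_distrib]
  refine Finset.sum_congr rfl fun i hi => ?_
  obtain ⟨h1, h2⟩ := Finset.mem_Icc.mp hi
  have hrow : ∀ j ∈ Finset.Icc i (m + 1),
      toPattern m c P i j = 1 + (countGE P (m + 1 - j) i : ℤ) := fun j hj =>
    toPattern_of_le h1 (Finset.mem_Icc.mp hj).1 (Finset.mem_Icc.mp hj).2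
  rw [Finset.sum_congr rfl hrow, Finset.sum_add_distrib]
  congr 1
  · simp
  · have hsub : Finset.range (m + 2 - i) ⊆ Finset.range (m + 1) :=
      Finset.range_subset_range.mpr (by omega)
    rw [← Finset.sum_subset hsub fun r _ hr => ?_]
    · refine Finset.sum_nbij' (fun j => m + 1 - j) (fun r => m + 1 - r) ?_ ?_ ?_ ?_ ?_ <;>
        simp only [Finset.mem_Icc, Finset.mem_range] <;> intros <;> first | omega | trivial
    · rw [Finset.mem_range] at hr
      rw [countGE_eq_zero P hP h1 (by omega), Nat.cast_zero]

theorem sum_row_lengths (m : ℕ) :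
    ∑ i ∈ Finset.Icc 1 (m + 1), ((m + 2 - i : ℕ) : ℤ) =
      (((m + 1 : ℕ) : ℤ) + 2) * (((m + 1 : ℕ) : ℤ) - 1) / 2 + 1 := by
  have hdouble : 2 * ∑ i ∈ Finset.Icc 1 (m + 1), ((m + 2 - i : ℕ) : ℤ) =
      ((m : ℤ) + 1) * (m + 2) := by
    have hrev : ∑ i ∈ Finset.Icc 1 (m + 1), ((m + 2 - i : ℕ) : ℤ) =
        ∑ i ∈ Finset.Icc 1 (m + 1), (i : ℤ) := by
      refine Finset.sum_nbij' (fun i => m + 2 - i) (fun i => m + 2 - i) ?_ ?_ ?_ ?_ ?_ <;>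
        simp only [Finset.mem_Icc] <;> intros <;> first | omega | trivial
    rw [hrev]
    clear hrev
    induction m with
    | zero => simp
    | succ m ih =>
      rw [Finset.sum_Icc_succ_top (by omega), mul_add, ih]
      push_cast
      ring
  have hprod : (((m + 1 : ℕ) : ℤ) + 2) * (((m + 1 : ℕ) : ℤ) - 1) =
      ((m : ℤ) + 1) * (m + 2) - 2 := by
    push_cast
    ring
  omega

theorem q_ne_zero : q ≠ 0 := RatFunc.X_ne_zero

/-- **Lemma (initial conditions), third identity:**
`F_q(n-1,n,c,n;1) = q^{(n+2)(n-1)/2} G_{n-1,c-1,0}`. -/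
theorem statement13 (n c : ℕ) (hn : 1 ≤ n) (hc : 1 ≤ c) :
    Fq n c n 1 =
      q ^ ((((n : ℤ) + 2) * ((n : ℤ) - 1)) / 2) * Gspp (n - 1) (c - 1) 0 := by
  obtain ⟨m, rfl⟩ : ∃ m, n = m + 1 := ⟨n - 1, by omega⟩
  have hbij : Set.BijOn (toPattern m c) (evenSPP m (c - 1)) (oddPatterns m c) :=
    ⟨fun _ => toPattern_mem hc, toPattern_injOn m c, toPattern_surjOn hc⟩
  have hterm : ∀ P ∈ evenSPP m (c - 1),
      q ^ (((((m + 1 : ℕ) : ℤ) + 2) * (((m + 1 : ℕ) : ℤ) - 1)) / 2 + 1) * q ^ sppNorm P =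
        patSign m (m + 1) (toPattern m c P) * q ^ patNorm m (m + 1) (toPattern m c P) := by
    intro P hP
    have hmem := toPattern_mem hc hP
    rw [patSign, hmem.1.invCount_eq_zero hc hmem.2.1, pow_zero, one_mul,
      patNorm_toPattern hP.1 hP.2.1, sum_row_lengths, zpow_add₀ q_ne_zero _ (sppNorm P : ℤ),
      zpow_natCast]
  have hsum := finsum_mem_eq_of_bijOn (g := fun a => patSign m (m + 1) a * q ^ patNorm m (m + 1) a)
    _ hbij hterm
  change (∑ᶠ a ∈ oddPatterns m c, patSign m (m + 1) a * q ^ patNorm m (m + 1) a) / q ^ (1 : ℤ) =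
    _ * ∑ᶠ P ∈ evenSPP m (c - 1), q ^ sppNorm P
  rw [← hsum, zpow_add₀ q_ne_zero, zpow_one]
  simp only [← smul_eq_mul, ← smul_finsum]
  simp only [smul_eq_mul]
  field_simp [q_ne_zero]
end

section
/- Let n ≥ 1 and c ≥ 0 be integers. Then, in ℚ(q): Σ_{i=1}^{n} (−1)^i q^{(n−i+1)(n−i)/2 + i} / ( [c+i;q]_n · [1;q]_{i−1} · [1;q]_{n−i} ) = − q^{(n−1)c + n(n+1)/2} · [1;q]_{2n−2} / ( [1;q]_{n−1}^2 · [c+1;q]_{2n−1} ). -/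
open Finset

/-- The `q`-Pochhammer symbol `(x; t)_m`. -/
def qPoch {R : Type*} [CommRing R] (t x : R) (m : ℕ) : R := ∏ i ∈ range m, (1 - x * t ^ i)

section qPoch

variable {R : Type*} [CommRing R] (t x : R)

@[simp]
lemma qPoch_zero : qPoch t x 0 = 1 := by simp [qPoch]

lemma qPoch_succ (m : ℕ) : qPoch t x (m + 1) = qPoch t x m * (1 - x * t ^ m) :=
  prod_range_succ _ _

lemma qPoch_add (m n : ℕ) : qPoch t x (m + n) = qPoch t x m * qPoch t (x * t ^ m) n := by
  simp only [qPoch, prod_range_add, pow_add, mul_assoc]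

lemma qPoch_succ' (m : ℕ) : qPoch t x (m + 1) = (1 - x) * qPoch t (x * t) m := by
  rw [add_comm, qPoch_add]
  simp [qPoch]

end qPoch

lemma triangle_succ (l : ℕ) : (l + 1 + 1) * (l + 1) / 2 = (l + 1) * l / 2 + (l + 1) := by
  rw [show (l + 1 + 1) * (l + 1) = (l + 1) * l + (l + 1) * 2 by ring]
  exact Nat.add_mul_div_right _ _ two_pos

/-- The summand of the `q`-Chu-Vandermonde sum, with `k + l` the length of the sum. -/
def qVandermondeTerm {K : Type*} [Field K] (t a b : K) (k l : ℕ) : K :=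
  (-1) ^ k * t ^ ((l + 1) * l / 2 + k) * qPoch t a k * qPoch t (b * t ^ k) l /
    (qPoch t t k * qPoch t t l)

section Vandermonde

variable {K : Type*} [Field K] {t : K}

lemma one_sub_mul_pow_ne_zero (ht : ∀ m : ℕ, t ^ (m + 1) ≠ 1) (m : ℕ) : 1 - t * t ^ m ≠ 0 := by
  rw [← pow_succ', sub_ne_zero]
  exact (ht m).symm

lemma qPoch_self_ne_zero (ht : ∀ m : ℕ, t ^ (m + 1) ≠ 1) (m : ℕ) : qPoch t t m ≠ 0 :=
  prod_ne_zero_iff.mpr fun i _ => one_sub_mul_pow_ne_zero ht i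

lemma qVandermondeTerm_succ_right (ht : ∀ m : ℕ, t ^ (m + 1) ≠ 1) (a b : K) (k l : ℕ) :
    t ^ k * (1 - t * t ^ l) * qVandermondeTerm t a b k (l + 1) =
      t ^ (k + l + 1) * (1 - b * t ^ (k + l)) * qVandermondeTerm t a b k l := by
  have h₁ := one_sub_mul_pow_ne_zero ht l
  have h₂ := qPoch_self_ne_zero ht k
  have h₃ := qPoch_self_ne_zero ht l
  rw [qVandermondeTerm, qVandermondeTerm, triangle_succ, qPoch_succ, qPoch_succ]
  field_simp
  ring

lemma qVandermondeTerm_succ_left (ht : ∀ m : ℕ, t ^ (m + 1) ≠ 1) (a b : K) (k l : ℕ) :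
    (1 - t * t ^ k) * qVandermondeTerm t a b (k + 1) l =
      -(t * (1 - a) * qVandermondeTerm t (a * t) (b * t) k l) := by
  have h₁ := one_sub_mul_pow_ne_zero ht k
  have h₂ := qPoch_self_ne_zero ht k
  have h₃ := qPoch_self_ne_zero ht l
  rw [qVandermondeTerm, qVandermondeTerm, qPoch_succ t t, qPoch_succ' t a,
    show b * t ^ (k + 1) = b * t * t ^ k by ring]
  field_simp
  ring

/-- The `q`-Chu-Vandermonde summation. -/
lemma sum_qVandermondeTerm (ht : ∀ m : ℕ, t ^ (m + 1) ≠ 1) (N : ℕ) (a b : K) :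
    ∑ p ∈ antidiagonal N, qVandermondeTerm t a b p.1 p.2 =
      t ^ ((N + 1) * N / 2) * (∏ j ∈ range N, (a - b * t ^ j)) / qPoch t t N := by
  induction N generalizing a b with
  | zero => simp [qVandermondeTerm]
  | succ N ih =>
    have h₁ := one_sub_mul_pow_ne_zero ht N
    have h₂ := qPoch_self_ne_zero ht N
    have hsplit : (1 - t * t ^ N) *
          ∑ p ∈ antidiagonal (N + 1), qVandermondeTerm t a b p.1 p.2 =
        ∑ p ∈ antidiagonal (N + 1), t ^ p.1 * (1 - t ^ p.2) * qVandermondeTerm t a b p.1 p.2 +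
          ∑ p ∈ antidiagonal (N + 1), (1 - t ^ p.1) * qVandermondeTerm t a b p.1 p.2 := by
      rw [mul_sum, ← sum_add_distrib]
      refine sum_congr rfl fun p hp => ?_
      rw [← pow_succ', ← mem_antidiagonal.mp hp, pow_add]
      ring
    have hright : ∑ p ∈ antidiagonal (N + 1),
          t ^ p.1 * (1 - t ^ p.2) * qVandermondeTerm t a b p.1 p.2 =
        t ^ (N + 1) * (1 - b * t ^ N) *
          ∑ p ∈ antidiagonal N, qVandermondeTerm t a b p.1 p.2 := by
      rw [Finset.Nat.sum_antidiagonal_succ', mul_sum]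
      simp only [pow_zero, sub_self, mul_zero, zero_mul, zero_add]
      refine sum_congr rfl fun p hp => ?_
      rw [pow_succ' t p.2, qVandermondeTerm_succ_right ht, mem_antidiagonal.mp hp]
    have hleft : ∑ p ∈ antidiagonal (N + 1), (1 - t ^ p.1) * qVandermondeTerm t a b p.1 p.2 =
        -(t * (1 - a)) *
          ∑ p ∈ antidiagonal N, qVandermondeTerm t (a * t) (b * t) p.1 p.2 := by
      rw [Finset.Nat.sum_antidiagonal_succ, mul_sum]
      simp only [pow_zero, sub_self, zero_mul, zero_add]
      refine sum_congr rfl fun p _ => ?_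
      rw [pow_succ' t p.1, qVandermondeTerm_succ_left ht, neg_mul]
    have hprod : ∏ j ∈ range N, (a * t - b * t * t ^ j) =
        t ^ N * ∏ j ∈ range N, (a - b * t ^ j) := by
      rw [← card_range N, ← prod_const, card_range, ← prod_mul_distrib]
      exact prod_congr rfl fun j _ => by ring
    rw [qPoch_succ, eq_div_iff (mul_ne_zero h₂ h₁), mul_left_comm, mul_comm _ (1 - t * t ^ N),
      hsplit, hright, hleft, ih, ih, hprod, triangle_succ, prod_range_succ]
    field_simp
    ring

end Vandermonde

lemma q_pow_succ_ne_one (m : ℕ) : q ^ (m + 1) ≠ 1 := by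
  intro h
  have h' : algebraMap (Polynomial ℚ) (RatFunc ℚ) (Polynomial.X ^ (m + 1)) =
      algebraMap (Polynomial ℚ) (RatFunc ℚ) 1 := by
    simpa [q] using h
  have hdeg := congrArg Polynomial.natDegree (RatFunc.algebraMap_injective ℚ h')
  simp at hdeg

lemma one_sub_q_ne_zero : 1 - q ≠ 0 := by
  simpa using one_sub_mul_pow_ne_zero q_pow_succ_ne_one 0

lemma qPoch_q_pow_ne_zero (a n : ℕ) : qPoch q (q ^ (a + 1)) n ≠ 0 := by
  refine prod_ne_zero_iff.mpr fun i _ => ?_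
  rw [← pow_add, show a + 1 + i = (a + i) + 1 by ring, sub_ne_zero]
  exact (q_pow_succ_ne_one _).symm

lemma qfac_natCast (a n : ℕ) : qfac a n = qPoch q (q ^ a) n / (1 - q) ^ n := by
  rw [← card_range n, ← prod_const, card_range, qPoch, ← prod_div_distrib, qfac]
  refine prod_congr rfl fun i _ => ?_
  rw [qb, ← pow_add, ← Nat.cast_add, zpow_natCast]

lemma qfac_one (n : ℕ) : qfac 1 n = qPoch q q n / (1 - q) ^ n := by
  simpa using qfac_natCast 1 n

lemma summand_eq_qVandermondeTerm (c k l : ℕ) :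
    (-1 : RatFunc ℚ) ^ (k + 1) * q ^ ((l + 1) * l / 2 + (k + 1)) /
        (qfac (c + (k + 1 : ℕ)) (k + l + 1) * qfac 1 k * qfac 1 l) =
      -(q * (1 - q) ^ (2 * (k + l) + 1) / qPoch q (q ^ (c + 1)) (2 * (k + l) + 1)) *
        qVandermondeTerm q (q ^ (c + 1)) (q ^ (c + (k + l) + 2)) k l := by
  have h₀ := one_sub_q_ne_zero
  have h₁ := qPoch_self_ne_zero q_pow_succ_ne_one k
  have h₂ := qPoch_self_ne_zero q_pow_succ_ne_one l
  have h₃ := qPoch_q_pow_ne_zero c k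
  have h₄ := qPoch_q_pow_ne_zero (c + k) (k + l + 1)
  have h₅ := qPoch_q_pow_ne_zero (c + (k + l) + 1 + k) l
  have hsplit : qPoch q (q ^ (c + 1)) (2 * (k + l) + 1) =
      qPoch q (q ^ (c + 1)) k * qPoch q (q ^ (c + k + 1)) (k + l + 1) *
        qPoch q (q ^ (c + (k + l) + 1 + k + 1)) l := by
    rw [show 2 * (k + l) + 1 = k + (k + l + 1) + l by ring, qPoch_add, qPoch_add,
      ← pow_add, ← pow_add, show c + 1 + k = c + k + 1 by ring,
      show c + 1 + (k + (k + l + 1)) = c + (k + l) + 1 + k + 1 by ring]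
  rw [← Nat.cast_add, qfac_natCast, qfac_one, qfac_one, hsplit, qVandermondeTerm, ← pow_add,
    show c + (k + l) + 2 + k = c + (k + l) + 1 + k + 1 by ring,
    show c + (k + 1) = c + k + 1 by ring]
  field_simp
  ring

lemma prod_q_pow_sub (c N : ℕ) :
    ∏ j ∈ range N, (q ^ (c + 1) - q ^ (c + N + 2) * q ^ j) =
      q ^ ((c + 1) * N) * qPoch q (q ^ (N + 1)) N := by
  rw [pow_mul, ← card_range N, ← prod_const, card_range, qPoch, ← prod_mul_distrib]
  exact prod_congr rfl fun j _ => by ring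


/-- **Identity (18):** a `q`-Chu-Vandermonde-type summation. -/
theorem statement18 (n c : ℕ) (hn : 1 ≤ n) :
    ∑ i ∈ Finset.Icc 1 n,
        (-1 : RatFunc ℚ) ^ i * q ^ ((n - i + 1) * (n - i) / 2 + i) /
          (qfac (c + i) n * qfac 1 (i - 1) * qfac 1 (n - i)) =
      -(q ^ ((n - 1) * c + n * (n + 1) / 2) * qfac 1 (2 * n - 2) /
        (qfac 1 (n - 1) ^ 2 * qfac (c + 1) (2 * n - 1))) := by
  obtain ⟨N, rfl⟩ : ∃ N, n = N + 1 := ⟨n - 1, by omega⟩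
  have hsum : ∑ i ∈ Finset.Icc 1 (N + 1),
      (-1 : RatFunc ℚ) ^ i * q ^ ((N + 1 - i + 1) * (N + 1 - i) / 2 + i) /
        (qfac (c + i) (N + 1) * qfac 1 (i - 1) * qfac 1 (N + 1 - i)) =
      ∑ p ∈ antidiagonal N,
        -(q * (1 - q) ^ (2 * N + 1) / qPoch q (q ^ (c + 1)) (2 * N + 1)) *
          qVandermondeTerm q (q ^ (c + 1)) (q ^ (c + N + 2)) p.1 p.2 := by
    rw [Finset.Nat.sum_antidiagonal_eq_sum_range_succ_mk, ← Ico_add_one_right_eq_Icc,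
      sum_Ico_eq_sum_range, Nat.add_sub_cancel]
    refine sum_congr rfl fun k hk => ?_
    obtain ⟨l, rfl⟩ := Nat.exists_eq_add_of_le (Nat.lt_succ_iff.mp (mem_range.mp hk))
    simpa only [add_comm 1 k, Nat.add_sub_cancel, Nat.add_sub_cancel_left,
      show k + l + 1 - (k + 1) = l by omega] using summand_eq_qVandermondeTerm c k l
  have h₀ := one_sub_q_ne_zero
  have h₁ := qPoch_self_ne_zero q_pow_succ_ne_one N
  have h₂ := qPoch_q_pow_ne_zero c (2 * N + 1)
  have hdouble : qPoch q q (2 * N) = qPoch q q N * qPoch q (q ^ (N + 1)) N := by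
    rw [two_mul, qPoch_add, ← pow_succ']
  have hexp : (N + 1) * (N + 1 + 1) / 2 = (N + 1) * N / 2 + (N + 1) := by
    rw [mul_comm, triangle_succ]
  rw [hsum, ← mul_sum, sum_qVandermondeTerm q_pow_succ_ne_one, prod_q_pow_sub,
    show 2 * (N + 1) - 2 = 2 * N by omega, show 2 * (N + 1) - 1 = 2 * N + 1 by omega,
    Nat.add_sub_cancel, hexp, ← Nat.cast_one (R := ℤ), ← Nat.cast_add, qfac_natCast (c + 1),
    Nat.cast_one, qfac_one, qfac_one, hdouble]
  field_simp
  ring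
end
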